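/- arXiv:2004.00194 — 2 statements merged into one kernel-verified Lean document; each statement's English description precedes it below -/
import Mathlib

section
/- Suppose each μ_j^k is continuously differentiable with |t · (μ_j^k)'(t)| ≤ β_j^k for all t ∈ ℝ (with β_j^k ≥ 0), and suppose the real numbers d_j^k satisfy 0 ≤ d_j^k ≤ d̄_j for all j, k. Let D = diag(d̄_1,…,d̄_n) and let β be any real number with β ≥ Σ_{j=1}^n Σ_{k=1}^{s_j} β_j^k. Then for all x, y ∈ ℝⁿ, the Hessian of V satisfies yᵀ (Hess V(x)) y ≤ 2 yᵀ P(x) y + 2 β yᵀ D y. -/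
open Matrix

/-- A product of normalized weights has the given weights as marginals. -/
theorem sum_pi_prod_mul {ι : Type*} [Fintype ι] [DecidableEq ι] {κ : ι → Type*}
    [∀ i, Fintype (κ i)] {R : Type*} [CommSemiring R] (w : ∀ i, κ i → R)
    (hw : ∀ i, ∑ k, w i k = 1) (m : ι) (g : κ m → R) :
    ∑ α : (∀ i, κ i), (∏ i, w i (α i)) * g (α m) = ∑ k, w m k * g k := by
  classical
  have h := Finset.prod_univ_sum (fun i => (Finset.univ : Finset (κ i)))
    (Function.update w m fun k => w m k * g k)
  rw [Fintype.piFinset_univ] at h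
  have hl : ∏ i, ∑ k, Function.update w m (fun k => w m k * g k) i k = ∑ k, w m k * g k := by
    rw [Fintype.prod_eq_single m]
    · simp
    · intro i hi
      simp [Function.update_of_ne hi, hw]
  rw [← hl, h]
  refine Finset.sum_congr rfl fun α _ => ?_
  rw [← Finset.mul_prod_erase _ _ (Finset.mem_univ m),
    ← Finset.mul_prod_erase _ (fun i => Function.update w m _ i (α i)) (Finset.mem_univ m)]
  have he : ∏ i ∈ Finset.univ.erase m, Function.update w m (fun k => w m k * g k) i (α i)
      = ∏ i ∈ Finset.univ.erase m, w i (α i) :=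
    Finset.prod_congr rfl fun i hi => by rw [Function.update_of_ne (Finset.ne_of_mem_erase hi)]
  rw [he, Function.update_self]
  ring

theorem sum_pi_prod {ι : Type*} [Fintype ι] [DecidableEq ι] {κ : ι → Type*}
    [∀ i, Fintype (κ i)] {R : Type*} [CommSemiring R] (w : ∀ i, κ i → R)
    (hw : ∀ i, ∑ k, w i k = 1) : ∑ α : (∀ i, κ i), ∏ i, w i (α i) = 1 := by
  have h := Finset.prod_univ_sum (fun i => (Finset.univ : Finset (κ i))) w
  rw [Fintype.piFinset_univ] at h
  simp [← h, hw]

theorem sum_pi_prod_smul_add_diagonal {ι : Type*} [Fintype ι] [DecidableEq ι] {κ : ι → Type*}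
    [∀ i, Fintype (κ i)] {R : Type*} [CommSemiring R] (w : ∀ i, κ i → R)
    (hw : ∀ i, ∑ k, w i k = 1) (A : Matrix ι ι R) (d : ∀ i, κ i → R) :
    ∑ α : (∀ i, κ i), (∏ i, w i (α i)) • (A + Matrix.diagonal fun m => d m (α m))
      = A + Matrix.diagonal fun m => ∑ k, w m k * d m k := by
  simp only [smul_add, Finset.sum_add_distrib, ← Finset.sum_smul, sum_pi_prod w hw, one_smul]
  congr 1
  ext i j
  rw [Matrix.sum_apply]
  rcases eq_or_ne i j with rfl | hij
  · simp [sum_pi_prod_mul w hw]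
  · simp [hij]

theorem dotProduct_diagonal_mulVec {ι : Type*} [Fintype ι] [DecidableEq ι] (y c : ι → ℝ) :
    y ⬝ᵥ (Matrix.diagonal c).mulVec y = ∑ i, c i * y i ^ 2 := by
  simp only [dotProduct, Matrix.mulVec_diagonal]
  exact Finset.sum_congr rfl fun i _ => by ring

theorem hasFDerivAt_sum_apply {ι : Type*} [Fintype ι] {F f : ι → ℝ → ℝ} (z : ι → ℝ)
    (hF : ∀ i, HasDerivAt (F i) (f i (z i)) (z i)) :
    HasFDerivAt (fun x : ι → ℝ => ∑ i, F i (x i))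
      (∑ i, f i (z i) • ContinuousLinearMap.proj (R := ℝ) (φ := fun _ : ι => ℝ) i) z :=
  HasFDerivAt.fun_sum fun i _ => (hF i).comp_hasFDerivAt z (hasFDerivAt_apply i z)

theorem hasFDerivAt_dotProduct_mulVec {ι : Type*} [Fintype ι] (A : Matrix ι ι ℝ) (z : ι → ℝ) :
    ∃ L : (ι → ℝ) →L[ℝ] ℝ, HasFDerivAt (fun x : ι → ℝ => x ⬝ᵥ A.mulVec x) L z ∧
      ∀ y, L y = z ⬝ᵥ A.mulVec y + y ⬝ᵥ A.mulVec z := by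
  have hA : ∀ i, HasFDerivAt (fun x : ι → ℝ => A.mulVec x i)
      (∑ j, A i j • ContinuousLinearMap.proj (R := ℝ) (φ := fun _ : ι => ℝ) j) z := fun i =>
    HasFDerivAt.fun_sum fun j _ => (hasFDerivAt_apply j z).const_mul (A i j)
  refine ⟨_, HasFDerivAt.fun_sum fun i _ => (hasFDerivAt_apply i z).mul (hA i), fun y => ?_⟩
  simp [dotProduct, Matrix.mulVec, Finset.sum_add_distrib, mul_comm]

/-- The second derivative of a quadratic form plus a separable function. -/
theorem fderiv_fderiv_quadratic_add_separable {ι : Type*} [Fintype ι] (A : Matrix ι ι ℝ)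
    (hA : Aᵀ = A) {F f f' : ι → ℝ → ℝ} (hF : ∀ i t, HasDerivAt (F i) (f i t) t)
    (hf : ∀ i t, HasDerivAt (f i) (f' i t) t) (x y : ι → ℝ) :
    fderiv ℝ (fun z : ι → ℝ =>
        fderiv ℝ (fun v : ι → ℝ => v ⬝ᵥ A.mulVec v + 2 * ∑ i, F i (v i)) z y) x y
      = 2 * (y ⬝ᵥ A.mulVec y) + 2 * ∑ i, f' i (x i) * y i ^ 2 := by
  have hfst : ∀ z : ι → ℝ,
      fderiv ℝ (fun v : ι → ℝ => v ⬝ᵥ A.mulVec v + 2 * ∑ i, F i (v i)) z y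
        = 2 * ∑ i, (A.mulVec y i * z i + y i * f i (z i)) := by
    intro z
    obtain ⟨L, hL, hLy⟩ := hasFDerivAt_dotProduct_mulVec A z
    have hsymm : y ⬝ᵥ A.mulVec z = z ⬝ᵥ A.mulVec y := by
      rw [Matrix.dotProduct_mulVec, ← Matrix.mulVec_transpose, hA, dotProduct_comm]
    rw [(hL.fun_add ((hasFDerivAt_sum_apply z fun i => hF i (z i)).const_mul 2)).fderiv]
    simp only [_root_.add_apply, _root_.smul_apply, _root_.sum_apply,
      ContinuousLinearMap.proj_apply, smul_eq_mul, hLy, hsymm]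
    rw [← two_mul, ← mul_add, dotProduct, ← Finset.sum_add_distrib]
    congr 1
    exact Finset.sum_congr rfl fun i _ => by ring
  simp only [hfst]
  have hsnd := (hasFDerivAt_sum_apply (F := fun i t => A.mulVec y i * t + y i * f i t)
    (f := fun i t => A.mulVec y i * 1 + y i * f' i t) x fun i =>
      ((hasDerivAt_id (x i)).const_mul _).add ((hf i (x i)).const_mul _)).const_mul 2
  rw [hsnd.fderiv]
  simp only [_root_.smul_apply, _root_.sum_apply,
    ContinuousLinearMap.proj_apply, smul_eq_mul, dotProduct]
  rw [← mul_add, ← Finset.sum_add_distrib]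
  congr 1
  exact Finset.sum_congr rfl fun i _ => by ring

/-- Estimate for the Hessian of the line-integral Lyapunov function: if
`|t (μ_j^k)'(t)| ≤ β_j^k`, `0 ≤ d_j^k ≤ d̄_j`, `D = diag(d̄)` and
`β ≥ ∑_j ∑_k β_j^k`, then `yᵀ Hess V(x) y ≤ 2 yᵀ P(x) y + 2 β yᵀ D y`. -/
theorem stmt_8 (n : ℕ) (hn : 1 ≤ n) (s : Fin n → ℕ) (hs : ∀ j, 1 ≤ s j)
    (μ : (j : Fin n) → Fin (s j) → ℝ → ℝ)
    (hμ0 : ∀ j k t, 0 ≤ μ j k t) (hμ1 : ∀ j k t, μ j k t ≤ 1)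
    (hμsum : ∀ (j : Fin n) (t : ℝ), ∑ k, μ j k t = 1)
    (hsmooth : ∀ j k, ContDiff ℝ 1 (μ j k))
    (βjk : (j : Fin n) → Fin (s j) → ℝ) (hβjk : ∀ j k, 0 ≤ βjk j k)
    (hbound : ∀ j k (t : ℝ), |t * deriv (μ j k) t| ≤ βjk j k)
    (Pbar : Matrix (Fin n) (Fin n) ℝ) (hPbar : Pbarᵀ = Pbar)
    (hPbardiag : ∀ j, Pbar j j = 0)
    (d : (j : Fin n) → Fin (s j) → ℝ) (dbar : Fin n → ℝ)
    (hd0 : ∀ j k, 0 ≤ d j k) (hd1 : ∀ j k, d j k ≤ dbar j)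
    (β : ℝ) (hβ : (∑ j, ∑ k, βjk j k) ≤ β)
    (V : (Fin n → ℝ) → ℝ)
    (hV : ∀ x, V x = x ⬝ᵥ Pbar.mulVec x
        + 2 * ∑ j, ∑ k, d j k * ∫ t in (0:ℝ)..(x j), t * μ j k t) :
    ∀ x y : Fin n → ℝ,
      fderiv ℝ (fun z : Fin n → ℝ => fderiv ℝ V z y) x y
        ≤ 2 * (y ⬝ᵥ ((∑ α : (∀ l, Fin (s l)), (∏ l, μ l (α l) (x l)) •
              (Pbar + Matrix.diagonal fun m => d m (α m))).mulVec y))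
          + 2 * β * (y ⬝ᵥ ((Matrix.diagonal dbar).mulVec y)) := by
  intro x y
  have hcont : ∀ j k, Continuous (μ j k) := fun j k => (hsmooth j k).continuous
  have hderiv : ∀ j k t, HasDerivAt (μ j k) (deriv (μ j k) t) t := fun j k t =>
    ((hsmooth j k).differentiable (by norm_num) t).hasDerivAt
  have hF : ∀ j t, HasDerivAt (fun u => ∑ k, d j k * ∫ r in (0:ℝ)..u, r * μ j k r)
      (∑ k, d j k * (t * μ j k t)) t := fun j t =>
    HasDerivAt.fun_sum fun k _ =>
      ((continuous_id.mul (hcont j k)).integral_hasStrictDerivAt 0 t).hasDerivAt.const_mul _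
  have hf : ∀ j t, HasDerivAt (fun u => ∑ k, d j k * (u * μ j k u))
      (∑ k, d j k * (1 * μ j k t + t * deriv (μ j k) t)) t := fun j t =>
    HasDerivAt.fun_sum fun k _ => ((hasDerivAt_id t).mul (hderiv j k t)).const_mul _
  rw [funext hV, fderiv_fderiv_quadratic_add_separable Pbar hPbar hF hf,
    sum_pi_prod_smul_add_diagonal (fun j k => μ j k (x j)) (fun j => hμsum j (x j)),
    Matrix.add_mulVec, dotProduct_add, dotProduct_diagonal_mulVec, dotProduct_diagonal_mulVec]
  have hrow : ∀ j, ∑ k, d j k * (x j * deriv (μ j k) (x j)) ≤ β * dbar j := by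
    intro j
    have hdbar : 0 ≤ dbar j := (hd0 j ⟨0, hs j⟩).trans (hd1 j ⟨0, hs j⟩)
    have hβj : ∑ k, βjk j k ≤ β :=
      (Finset.single_le_sum (f := fun j => ∑ k, βjk j k)
        (fun i _ => Finset.sum_nonneg fun k _ => hβjk i k) (Finset.mem_univ j)).trans hβ
    calc ∑ k, d j k * (x j * deriv (μ j k) (x j)) ≤ ∑ k, dbar j * βjk j k :=
          Finset.sum_le_sum fun k _ =>
            (mul_le_mul_of_nonneg_left ((le_abs_self _).trans (hbound j k _)) (hd0 j k)).trans
              (mul_le_mul_of_nonneg_right (hd1 j k) (hβjk j k))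
      _ = (∑ k, βjk j k) * dbar j := by rw [← Finset.mul_sum, mul_comm]
      _ ≤ β * dbar j := mul_le_mul_of_nonneg_right hβj hdbar
  have hmain : ∑ j, (∑ k, d j k * (1 * μ j k (x j) + x j * deriv (μ j k) (x j))) * y j ^ 2
      ≤ ∑ j, (∑ k, μ j k (x j) * d j k) * y j ^ 2 + β * ∑ j, dbar j * y j ^ 2 := by
    rw [Finset.mul_sum, ← Finset.sum_add_distrib]
    refine Finset.sum_le_sum fun j _ => ?_
    have hsplit : ∑ k, d j k * (1 * μ j k (x j) + x j * deriv (μ j k) (x j))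
        = ∑ k, μ j k (x j) * d j k + ∑ k, d j k * (x j * deriv (μ j k) (x j)) := by
      rw [← Finset.sum_add_distrib]
      exact Finset.sum_congr rfl fun k _ => by ring
    rw [hsplit, add_mul, ← mul_assoc]
    gcongr
    exact hrow j
  linarith
end

section
/- (Deterministic core of Theorem 1.) Let s ≥ 1, let A_i, C_i (1 ≤ i ≤ s) be real n×n matrices, P_j (1 ≤ j ≤ s) symmetric real n×n matrices, D a diagonal real n×n matrix, and β ≥ 0 a real number such that each P_j + βD is positive semidefinite. Let Q_{ij} (1 ≤ i, j ≤ s) be symmetric real n×n matrices with Q_{ij} = Q_{ji}. Assume that for all i, j the matrix (P_j A_i)^S + C_iᵀ (P_j + βD) C_i + Q_{ij} is negative definite, and that the sn×sn block matrix Θ₁ with (i,j) block Q_{ij} is positive definite. Then for every x ∈ ℝⁿ with x ≠ 0 and every h ∈ ℝ^s with h_i ≥ 0 and Σ_{i=1}^s h_i = 1, Σ_{i=1}^s Σ_{j=1}^s Σ_{k=1}^s h_i h_j h_k · xᵀ [ P_j A_i + (1/2) C_iᵀ (P_j + βD) C_k ]^S x < 0. -/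
open Matrix

/-- A quadratic form with a positive semidefinite matrix satisfies the symmetrised inequality
`uᵀMv + vᵀMu ≤ uᵀMu + vᵀMv`. -/
theorem Matrix.PosSemidef.dotProduct_mulVec_add_le {ι : Type*} [Fintype ι]
    {M : Matrix ι ι ℝ} (hM : M.PosSemidef) (u v : ι → ℝ) :
    u ⬝ᵥ M *ᵥ v + v ⬝ᵥ M *ᵥ u ≤ u ⬝ᵥ M *ᵥ u + v ⬝ᵥ M *ᵥ v := by
  have h := hM.dotProduct_mulVec_nonneg (u - v)
  simp only [star_trivial, mulVec_sub, sub_dotProduct, dotProduct_sub] at h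
  linarith

theorem Matrix.dotProduct_add_transpose_mulVec {ι : Type*} [Fintype ι]
    (M : Matrix ι ι ℝ) (x : ι → ℝ) :
    x ⬝ᵥ (M + Mᵀ) *ᵥ x = 2 * (x ⬝ᵥ M *ᵥ x) := by
  rw [add_mulVec, dotProduct_add, mulVec_transpose, dotProduct_comm x (x ᵥ* M),
    ← dotProduct_mulVec]
  ring

theorem Matrix.dotProduct_transpose_mul_mul_mulVec {ι : Type*} [Fintype ι]
    (B M C : Matrix ι ι ℝ) (x : ι → ℝ) :
    x ⬝ᵥ (Bᵀ * M * C) *ᵥ x = (B *ᵥ x) ⬝ᵥ M *ᵥ (C *ᵥ x) := by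
  rw [← mulVec_mulVec, ← mulVec_mulVec, dotProduct_mulVec, vecMul_transpose]

/-- Evaluating a positive definite block matrix at `(hᵢ x)ᵢ`. -/
theorem Matrix.PosDef.sum_mul_mul_block_pos {σ ι : Type*} [Fintype σ] [Fintype ι]
    {Q : σ → σ → Matrix ι ι ℝ}
    (hQ : (Matrix.of fun p q : σ × ι => Q p.1 q.1 p.2 q.2).PosDef)
    {x : ι → ℝ} (hx : x ≠ 0) {h : σ → ℝ} (hh : h ≠ 0) :
    0 < ∑ i, ∑ j, h i * h j * (x ⬝ᵥ Q i j *ᵥ x) := by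
  obtain ⟨a, ha⟩ := Function.ne_iff.mp hx
  obtain ⟨i, hi⟩ := Function.ne_iff.mp hh
  have hne : (fun p : σ × ι => h p.1 * x p.2) ≠ 0 :=
    Function.ne_iff.mpr ⟨(i, a), mul_ne_zero hi ha⟩
  refine (hQ.dotProduct_mulVec_pos hne).trans_eq (Eq.symm ?_)
  simp only [dotProduct, mulVec, star_trivial, of_apply, Fintype.sum_prod_type, Finset.mul_sum]
  refine Finset.sum_congr rfl fun i _ => ?_
  rw [Finset.sum_comm]
  refine Finset.sum_congr rfl fun a _ => Finset.sum_congr rfl fun j _ =>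
    Finset.sum_congr rfl fun b _ => ?_
  ring

/-- Averaging with convex weights: bounding `m i j k` by the mean of `b i j` and `b k j` reduces a
triple sum to a double sum. -/
theorem sum_mul_mul_mul_add_le {σ : Type*} [Fintype σ] {h : σ → ℝ} (h0 : ∀ i, 0 ≤ h i)
    (h1 : ∑ i, h i = 1) (a b : σ → σ → ℝ) (m : σ → σ → σ → ℝ)
    (hm : ∀ i j k, m i j k + m k j i ≤ b i j + b k j) :
    ∑ i, ∑ j, ∑ k, h i * h j * h k * (a i j + m i j k) ≤
      ∑ i, ∑ j, h i * h j * (a i j + b i j) := by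
  have swap (f : σ → σ → σ → ℝ) :
      ∑ i, ∑ j, ∑ k, h i * h j * h k * f k j i = ∑ i, ∑ j, ∑ k, h i * h j * h k * f i j k := by
    rw [Finset.sum_comm, Finset.sum_comm (f := fun i j => ∑ k, h i * h j * h k * f i j k)]
    refine Finset.sum_congr rfl fun j _ => ?_
    rw [Finset.sum_comm]
    refine Finset.sum_congr rfl fun i _ => Finset.sum_congr rfl fun k _ => ?_
    ring
  have contract (c : σ → σ → ℝ) :
      ∑ i, ∑ j, ∑ k, h i * h j * h k * c i j = ∑ i, ∑ j, h i * h j * c i j := by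
    refine Finset.sum_congr rfl fun i _ => Finset.sum_congr rfl fun j _ => ?_
    rw [← Finset.sum_mul, ← Finset.mul_sum, h1, mul_one]
  have hle : ∑ i, ∑ j, ∑ k, h i * h j * h k * (m i j k + m k j i) ≤
      ∑ i, ∑ j, ∑ k, h i * h j * h k * (b i j + b k j) :=
    Finset.sum_le_sum fun i _ => Finset.sum_le_sum fun j _ => Finset.sum_le_sum fun k _ =>
      mul_le_mul_of_nonneg_left (hm i j k) (mul_nonneg (mul_nonneg (h0 i) (h0 j)) (h0 k))
  have hb := swap fun i j _ => b i j
  have hms := swap m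
  simp only [mul_add, Finset.sum_add_distrib] at hle ⊢
  rw [hms, hb, contract b] at hle
  rw [contract a]
  linarith

/-- Deterministic core of Theorem 1: under the LMI conditions
`(P_j A_i)^S + C_iᵀ(P_j + βD)C_i + Q_{ij} < 0` and `Θ₁ > 0`, the quantity that
upper-bounds `ℒV` along the line-integral Lyapunov function is negative:
`∑_{i,j,k} h_i h_j h_k xᵀ[P_j A_i + ½ C_iᵀ(P_j + βD)C_k]^S x < 0`. -/
theorem stmt_14 (n s : ℕ) (hs : 1 ≤ s)
    (A C : Fin s → Matrix (Fin n) (Fin n) ℝ)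
    (P : Fin s → Matrix (Fin n) (Fin n) ℝ) (hP : ∀ j, (P j)ᵀ = P j)
    (d : Fin n → ℝ) (β : ℝ) (hβ : 0 ≤ β)
    (hPD : ∀ j, (P j + β • Matrix.diagonal d).PosSemidef)
    (Q : Fin s → Fin s → Matrix (Fin n) (Fin n) ℝ)
    (hQsymm : ∀ i j, (Q i j)ᵀ = Q i j) (hQswap : ∀ i j, Q i j = Q j i)
    (hneg : ∀ i j, (-(P j * A i + (P j * A i)ᵀ
        + (C i)ᵀ * (P j + β • Matrix.diagonal d) * C i + Q i j)).PosDef)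
    (hΘ : (Matrix.of fun p q : Fin s × Fin n => Q p.1 q.1 p.2 q.2).PosDef) :
    ∀ (x : Fin n → ℝ), x ≠ 0 → ∀ h : Fin s → ℝ, (∀ i, 0 ≤ h i) → (∑ i, h i = 1) →
      ∑ i, ∑ j, ∑ k, h i * h j * h k *
          (x ⬝ᵥ ((P j * A i + (1/2 : ℝ) • ((C i)ᵀ * (P j + β • Matrix.diagonal d) * C k)
            + (P j * A i + (1/2 : ℝ) • ((C i)ᵀ * (P j + β • Matrix.diagonal d) * C k))ᵀ).mulVec x))
        < 0 := by
  intro x hx h h0 h1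
  have hh : h ≠ 0 := by
    rintro rfl
    simp at h1
  have hQpos := hΘ.sum_mul_mul_block_pos hx hh
  let M : Fin s → Matrix (Fin n) (Fin n) ℝ := fun j => P j + β • Matrix.diagonal d
  have hterm (i j k : Fin s) :
      x ⬝ᵥ ((P j * A i + (1/2 : ℝ) • ((C i)ᵀ * M j * C k)
        + (P j * A i + (1/2 : ℝ) • ((C i)ᵀ * M j * C k))ᵀ) *ᵥ x) =
      2 * (x ⬝ᵥ (P j * A i) *ᵥ x) + (C i *ᵥ x) ⬝ᵥ M j *ᵥ (C k *ᵥ x) := by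
    rw [dotProduct_add_transpose_mulVec, add_mulVec, dotProduct_add, smul_mulVec,
      dotProduct_smul, dotProduct_transpose_mul_mul_mulVec, smul_eq_mul]
    ring
  have hLMI (i j : Fin s) :
      2 * (x ⬝ᵥ (P j * A i) *ᵥ x) + (C i *ᵥ x) ⬝ᵥ M j *ᵥ (C i *ᵥ x) ≤ -(x ⬝ᵥ Q i j *ᵥ x) := by
    have hpos := (hneg i j).dotProduct_mulVec_pos hx
    rw [star_trivial, neg_mulVec, dotProduct_neg, add_mulVec, dotProduct_add, add_mulVec,
      dotProduct_add, dotProduct_add_transpose_mulVec,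
      dotProduct_transpose_mul_mul_mulVec] at hpos
    linarith
  calc
    _ = ∑ i, ∑ j, ∑ k, h i * h j * h k *
          (2 * (x ⬝ᵥ (P j * A i) *ᵥ x) + (C i *ᵥ x) ⬝ᵥ M j *ᵥ (C k *ᵥ x)) :=
      Finset.sum_congr rfl fun i _ => Finset.sum_congr rfl fun j _ =>
        Finset.sum_congr rfl fun k _ => congrArg _ (hterm i j k)
    _ ≤ ∑ i, ∑ j, h i * h j *
          (2 * (x ⬝ᵥ (P j * A i) *ᵥ x) + (C i *ᵥ x) ⬝ᵥ M j *ᵥ (C i *ᵥ x)) :=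
      sum_mul_mul_mul_add_le h0 h1 (fun i j => 2 * (x ⬝ᵥ (P j * A i) *ᵥ x))
        (fun i j => (C i *ᵥ x) ⬝ᵥ M j *ᵥ (C i *ᵥ x))
        (fun i j k => (C i *ᵥ x) ⬝ᵥ M j *ᵥ (C k *ᵥ x))
        fun i j k => (hPD j).dotProduct_mulVec_add_le (C i *ᵥ x) (C k *ᵥ x)
    _ ≤ ∑ i, ∑ j, h i * h j * -(x ⬝ᵥ Q i j *ᵥ x) :=
      Finset.sum_le_sum fun i _ => Finset.sum_le_sum fun j _ =>
        mul_le_mul_of_nonneg_left (hLMI i j) (mul_nonneg (h0 i) (h0 j))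
    _ < 0 := by
      simpa only [mul_neg, Finset.sum_neg_distrib, neg_lt_zero] using hQpos
end
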